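/- arXiv:1912.08024 — 2 statements merged into one kernel-verified Lean document; each statement's English description precedes it below -/
import Mathlib

section
/- Let ℓ, m, λ_m : ℝ → ℝ be functions differentiable at t, with m(t) ≠ 0, let u, T_max be real numbers and c ≠ 0. Suppose m′(t) = −u·T_max/c and λ_m′(t) = −u·T_max·ℓ(t)/m(t)². Define S(s) = 1 − c·ℓ(s)/m(s) − λ_m(s). Then S is differentiable at t and S′(t) = −ℓ′(t)·c/m(t). In particular, the terms arising from the mass and mass-costate dynamics cancel exactly. -/
/-- With the mass dynamics `ṁ = -u·T_max/c` and mass-costate dynamics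
`λ̇_m = -u·T_max·ℓ/m²`, the time derivative of the switching function
`S = 1 - c·ℓ/m - λ_m` simplifies to `Ṡ = -ℓ̇·c/m`: the mass and
mass-costate terms cancel exactly. -/
theorem switching_function_derivative_simplified (ℓ m lm : ℝ → ℝ)
    (t u Tmax c : ℝ) (hc : c ≠ 0) (ℓ' m' lm' : ℝ)
    (hℓ : HasDerivAt ℓ ℓ' t) (hm : HasDerivAt m m' t) (hlm : HasDerivAt lm lm' t)
    (hmt : m t ≠ 0) (hm' : m' = -u * Tmax / c)
    (hlm' : lm' = -u * Tmax * ℓ t / (m t) ^ 2) :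
    HasDerivAt (fun s => 1 - c * ℓ s / m s - lm s) (-ℓ' * c / m t) t := by
  have h := (((hℓ.const_mul c).fun_div hm hmt).const_sub 1).fun_sub hlm
  refine h.congr_deriv ?_
  rw [hm', hlm']
  field_simp
  ring
end

section
/- Let φ, ψ : ℝ × ℝᵐ → ℝⁿ and τ : ℝᵐ → ℝ be differentiable at the relevant points, and let ξ₀ ∈ ℝᵐ with t_s = τ(ξ₀). Suppose the matching condition ψ(τ(ξ), ξ) = φ(τ(ξ), ξ) holds for all ξ in a neighborhood of ξ₀. Suppose moreover S : ℝⁿ → ℝ is differentiable at x_s = φ(t_s, ξ₀), that S(φ(τ(ξ), ξ)) = 0 near ξ₀, and that Ṡ := DS(x_s)(∂_t φ(t_s, ξ₀)) ≠ 0. Then, writing Ẋ⁻ = ∂_t φ(t_s, ξ₀) and Ẋ⁺ = ∂_t ψ(t_s, ξ₀), the parameter sensitivities before and after the switch are related by D_ξ ψ(t_s, ξ₀) = (Id + (1/Ṡ)·(Ẋ⁺ − Ẋ⁻) ⊗ DS(x_s)) ∘ D_ξ φ(t_s, ξ₀), where (v ⊗ L)(w) = L(w)·v denotes the rank-one linear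 map x ↦ L(x)·v. -/
section

variable {E F : Type*} [NormedAddCommGroup E] [NormedSpace ℝ E]
  [NormedAddCommGroup F] [NormedSpace ℝ F]

/-- Total derivative along a graph: `D_ξ [f (τ ξ, ξ)] v = (Dτ v) • ∂_t f + (D_ξ f) v`. -/
theorem hasFDerivAt_comp_graph {f : ℝ × E → F} {τ : E → ℝ} {x : E}
    (hf : DifferentiableAt ℝ f (τ x, x)) (hτ : DifferentiableAt ℝ τ x) :
    HasFDerivAt (fun y => f (τ y, y))
      ((fderiv ℝ τ x).smulRight (fderiv ℝ (fun t => f (t, x)) (τ x) 1) +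
        fderiv ℝ (fun y => f (τ x, y)) x) x := by
  have htime : HasFDerivAt (fun t => f (t, x))
      ((fderiv ℝ f (τ x, x)).comp (ContinuousLinearMap.inl ℝ ℝ E)) (τ x) :=
    hf.hasFDerivAt.comp (τ x) (hasFDerivAt_prodMk_left (τ x) x)
  have hspace : HasFDerivAt (fun y => f (τ x, y))
      ((fderiv ℝ f (τ x, x)).comp (ContinuousLinearMap.inr ℝ ℝ E)) x :=
    hf.hasFDerivAt.comp x (hasFDerivAt_prodMk_right (τ x) x)
  have hgraph : HasFDerivAt (fun y => f (τ y, y))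
      ((fderiv ℝ f (τ x, x)).comp ((fderiv ℝ τ x).prod (ContinuousLinearMap.id ℝ E))) x :=
    HasFDerivAt.comp (f := fun y => (τ y, y)) x hf.hasFDerivAt
      (hτ.hasFDerivAt.prodMk (hasFDerivAt_id x))
  rw [htime.fderiv, hspace.fderiv]
  refine hgraph.congr_fderiv (ContinuousLinearMap.ext fun v => ?_)
  simp [← map_smul, ← map_add]

end

/-- Jump of the sensitivity matrix across a bang-bang switching point:
`∂X⁺/∂ξ = (I + (Ẋ⁺ − Ẋ⁻) S_X / Ṡ) ∂X⁻/∂ξ`, where the rank-one correction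
`(Ẋ⁺ − Ẋ⁻) S_X` is the map `x ↦ (DS x_s)(x) • (Ẋ⁺ − Ẋ⁻)`. -/
theorem sensitivity_jump_at_switch (m n : ℕ)
    (φ ψ : ℝ × EuclideanSpace ℝ (Fin m) → EuclideanSpace ℝ (Fin n))
    (τ : EuclideanSpace ℝ (Fin m) → ℝ)
    (S : EuclideanSpace ℝ (Fin n) → ℝ)
    (ξ₀ : EuclideanSpace ℝ (Fin m)) (t_s : ℝ) (ht : t_s = τ ξ₀)
    (hφ : DifferentiableAt ℝ φ (t_s, ξ₀))
    (hψ : DifferentiableAt ℝ ψ (t_s, ξ₀))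
    (hτ : DifferentiableAt ℝ τ ξ₀)
    (hmatch : ∀ᶠ ξ in nhds ξ₀, ψ (τ ξ, ξ) = φ (τ ξ, ξ))
    (hS : DifferentiableAt ℝ S (φ (t_s, ξ₀)))
    (hzero : ∀ᶠ ξ in nhds ξ₀, S (φ (τ ξ, ξ)) = 0)
    (Sdot : ℝ)
    (hSdotdef : Sdot =
      fderiv ℝ S (φ (t_s, ξ₀)) (fderiv ℝ (fun t => φ (t, ξ₀)) t_s 1))
    (hSdot : Sdot ≠ 0) :
    fderiv ℝ (fun ξ => ψ (t_s, ξ)) ξ₀ =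
      (ContinuousLinearMap.id ℝ (EuclideanSpace ℝ (Fin n)) +
        Sdot⁻¹ • ((fderiv ℝ S (φ (t_s, ξ₀))).smulRight
          (fderiv ℝ (fun t => ψ (t, ξ₀)) t_s 1 -
            fderiv ℝ (fun t => φ (t, ξ₀)) t_s 1))).comp
        (fderiv ℝ (fun ξ => φ (t_s, ξ)) ξ₀) := by
  subst ht
  have hφ' := hasFDerivAt_comp_graph hφ hτ
  have hψ' := hasFDerivAt_comp_graph hψ hτ
  have hS' := HasFDerivAt.comp (f := fun ξ => φ (τ ξ, ξ)) ξ₀ hS.hasFDerivAt hφ'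
  have hstate := hψ'.unique (hφ'.congr_of_eventuallyEq hmatch)
  have hswitch := hS'.unique ((hasFDerivAt_const (0 : ℝ) ξ₀).congr_of_eventuallyEq hzero)
  ext1 v
  have hv := DFunLike.congr_fun hstate v
  have hτv := DFunLike.congr_fun hswitch v
  simp only [add_apply, ContinuousLinearMap.smulRight_apply,
    ContinuousLinearMap.comp_apply, zero_apply, map_add, map_smul,
    ← hSdotdef, smul_eq_mul] at hv hτv
  have hcoef : Sdot⁻¹ * fderiv ℝ S (φ (τ ξ₀, ξ₀)) (fderiv ℝ (fun ξ => φ (τ ξ₀, ξ)) ξ₀ v) =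
      -fderiv ℝ τ ξ₀ v := by
    field_simp
    linarith
  simp only [add_apply, ContinuousLinearMap.smulRight_apply,
    ContinuousLinearMap.comp_apply, smul_apply,
    ContinuousLinearMap.id_apply, smul_smul, hcoef]
  rw [eq_sub_of_add_eq' hv]
  module
end
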